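/- arXiv:1111.5448 — 2 statements merged into one kernel-verified Lean document; each statement's English description precedes it below -/
import Mathlib

section
/- Let (T, F) be a torsion theory in a homological category A satisfying condition (P). Then for every effective descent morphism f : A → B in A the following conditions are equivalent: (1) f is a normal extension with respect to the reflection F : A → F; (2) f is a central extension with respect to F; (3) the kernel K[f] lies in F. -/
open CategoryTheory CategoryTheory.Limits

universe v u v₂ u₂

namespace ProtoPaper

variable {C : Type u} [Category.{v} C]

section ZeroDefs

variable [HasZeroMorphisms C]

/-- `k` is a kernel of `f`. -/
def IsKernelOf {K A B : C} (k : K ⟶ A) (f : A ⟶ B) : Prop :=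
  ∃ w : k ≫ f = 0, Nonempty (IsLimit (KernelFork.ofι k w))

/-- `f` is a cokernel of `k`. -/
def IsCokernelOf {K A B : C} (f : A ⟶ B) (k : K ⟶ A) : Prop :=
  ∃ w : k ≫ f = 0, Nonempty (IsColimit (CokernelCofork.ofπ f w))

/-- A normal monomorphism: a kernel of some morphism. -/
def IsNormalMonoArrow {K A : C} (k : K ⟶ A) : Prop :=
  ∃ (B : C) (f : A ⟶ B), IsKernelOf k f

/-- A normal epimorphism: a cokernel of some morphism. -/
def IsNormalEpiArrow {A B : C} (f : A ⟶ B) : Prop :=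
  ∃ (K : C) (k : K ⟶ A), IsCokernelOf f k

/-- A split short exact sequence `0 → K → A ⇄ B → 0`. -/
structure IsSplitShortExact {K A B : C} (k : K ⟶ A) (f : A ⟶ B) (s : B ⟶ A) : Prop where
  isKernel : IsKernelOf k f
  split : s ≫ f = 𝟙 B

/-- A short exact sequence `0 → K → A → B → 0`. -/
structure IsShortExact {K A B : C} (k : K ⟶ A) (f : A ⟶ B) : Prop where
  isKernel : IsKernelOf k f
  isCokernel : IsCokernelOf f k

/-- A protosplit monomorphism: a kernel of a split epimorphism. -/
def IsProtosplitMono {K A : C} (k : K ⟶ A) : Prop :=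
  ∃ (B : C) (f : A ⟶ B) (s : B ⟶ A), IsSplitShortExact k f s

end ZeroDefs

/-- A pointed category is protomodular when the split short five lemma holds. -/
def IsProtomodular (C : Type u) [Category.{v} C] [HasZeroMorphisms C] : Prop :=
  ∀ ⦃K A B K' A' B' : C⦄ (k : K ⟶ A) (f : A ⟶ B) (s : B ⟶ A)
    (k' : K' ⟶ A') (f' : A' ⟶ B') (s' : B' ⟶ A')
    (κ : K ⟶ K') (α : A ⟶ A') (β : B ⟶ B'),
    IsSplitShortExact k f s → IsSplitShortExact k' f' s' →
    k ≫ α = κ ≫ k' → f ≫ β = α ≫ f' → s ≫ α = β ≫ s' →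
    IsIso κ → IsIso β → IsIso α

section Functors

variable {D : Type u₂} [Category.{v₂} D]

/-- A functor is protoadditive if it preserves split short exact sequences. -/
def IsProtoadditive [HasZeroMorphisms C] [HasZeroMorphisms D] (F : C ⥤ D) : Prop :=
  ∀ ⦃K A B : C⦄ (k : K ⟶ A) (f : A ⟶ B) (s : B ⟶ A),
    IsSplitShortExact k f s → IsSplitShortExact (F.map k) (F.map f) (F.map s)

/-- A functor preserves zero objects. -/
def PreservesZeroObjects (F : C ⥤ D) : Prop :=
  ∀ X : C, IsZero X → IsZero (F.obj X)

/-- A functor preserves pullbacks along split epimorphisms. -/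
def PreservesPullbacksAlongSplitEpis (F : C ⥤ D) : Prop :=
  ∀ ⦃P X Y Z : C⦄ (fst : P ⟶ X) (snd : P ⟶ Y) (f : X ⟶ Z) (g : Y ⟶ Z),
    IsSplitEpi f → IsPullback fst snd f g →
    IsPullback (F.map fst) (F.map snd) (F.map f) (F.map g)

end Functors

/-- A homological category: pointed, protomodular and regular (finitely complete with
pullback-stable (regular epi, mono) factorisations). -/
structure IsHomological (C : Type u) [Category.{v} C] [HasZeroObject C]
    [HasZeroMorphisms C] : Prop where
  protomodular : IsProtomodular C
  hasFiniteLimits : HasFiniteLimits C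
  regEpiMonoFac : ∀ ⦃X Y : C⦄ (f : X ⟶ Y),
    ∃ (I : C) (e : X ⟶ I) (m : I ⟶ Y), Nonempty (RegularEpi e) ∧ Mono m ∧ e ≫ m = f
  regEpiStable : ∀ ⦃P X Y Z : C⦄ (fst : P ⟶ X) (snd : P ⟶ Y) (f : X ⟶ Z) (g : Y ⟶ Z),
    IsPullback fst snd f g → Nonempty (RegularEpi f) → Nonempty (RegularEpi snd)

/-- An internal equivalence relation, given by a jointly monic pair which is internally
reflexive, symmetric and transitive. -/
structure IsInternalEquivRel {R X : C} (p₁ p₂ : R ⟶ X) : Prop where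
  jointlyMono : ∀ ⦃Z : C⦄ (a b : Z ⟶ R), a ≫ p₁ = b ≫ p₁ → a ≫ p₂ = b ≫ p₂ → a = b
  refl : ∃ d : X ⟶ R, d ≫ p₁ = 𝟙 X ∧ d ≫ p₂ = 𝟙 X
  symm : ∃ σ : R ⟶ R, σ ≫ p₁ = p₂ ∧ σ ≫ p₂ = p₁
  trans : ∀ ⦃P : C⦄ (q₁ q₂ : P ⟶ R), IsPullback q₁ q₂ p₂ p₁ →
    ∃ t : P ⟶ R, t ≫ p₁ = q₁ ≫ p₁ ∧ t ≫ p₂ = q₂ ≫ p₂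

/-- A semi-abelian category: homological, with binary coproducts, and exact
(every internal equivalence relation is a kernel pair). -/
structure IsSemiAbelian (C : Type u) [Category.{v} C] [HasZeroObject C]
    [HasZeroMorphisms C] : Prop where
  homological : IsHomological C
  hasBinaryCoproducts : HasBinaryCoproducts C
  equivRelEffective : ∀ ⦃R X : C⦄ (p₁ p₂ : R ⟶ X), IsInternalEquivRel p₁ p₂ →
    ∃ (Y : C) (f : X ⟶ Y), IsPullback p₁ p₂ f f

/-- A full subcategory (given by a predicate on objects) is replete if it is closed
under isomorphisms. -/
def Replete (P : C → Prop) : Prop := ∀ ⦃X Y : C⦄, P X → (X ≅ Y) → P Y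

/-- A reflection of `C` onto the full subcategory of objects satisfying `P`:
a reflector `F`, a unit `η`, landing in `P`, with the usual universal property. -/
structure Reflection (C : Type u) [Category.{v} C] (P : C → Prop) where
  F : C ⥤ C
  η : 𝟭 C ⟶ F
  mem : ∀ X : C, P (F.obj X)
  univ : ∀ ⦃X B : C⦄, P B → ∀ f : X ⟶ B, ∃! g : F.obj X ⟶ B, η.app X ≫ g = f

variable {P : C → Prop}

/-- A (normal epi)-reflection: all units are normal epimorphisms. -/
def NormalEpiUnits [HasZeroMorphisms C] (R : Reflection C P) : Prop :=
  ∀ X : C, IsNormalEpiArrow (R.η.app X)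

/-- `f` is a trivial extension with respect to the reflection `R`. -/
def IsTrivialExt (R : Reflection C P) {A B : C} (f : A ⟶ B) : Prop :=
  IsPullback (R.η.app A) f (R.F.map f) (R.η.app B)

/-- `p` is an effective descent morphism: the pullback functor between the slice
categories is monadic. -/
def IsEffectiveDescent [HasPullbacks C] {E B : C} (p : E ⟶ B) : Prop :=
  Nonempty (MonadicRightAdjoint (Over.pullback p))

/-- A central extension with respect to the (absolute) Galois structure of a reflection:
some pullback along an effective descent morphism is a trivial extension. -/
def IsCentralExt [HasPullbacks C] (R : Reflection C P) {A B : C} (f : A ⟶ B) : Prop :=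
  ∃ (E : C) (p : E ⟶ B), IsEffectiveDescent p ∧
    ∃ (Pb : C) (p1 : Pb ⟶ E) (p2 : Pb ⟶ A), IsPullback p1 p2 p f ∧ IsTrivialExt R p1

/-- A normal extension with respect to the (absolute) Galois structure of a reflection. -/
def IsNormalExt [HasPullbacks C] (R : Reflection C P) {A B : C} (f : A ⟶ B) : Prop :=
  IsEffectiveDescent f ∧
    ∃ (Pb : C) (p1 p2 : Pb ⟶ A), IsPullback p1 p2 f f ∧ IsTrivialExt R p1

/-- A central extension with respect to the Galois structure of a reflection relative to
the class of normal epimorphisms. -/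
def IsCentralExtN [HasZeroMorphisms C] (R : Reflection C P) {A B : C} (f : A ⟶ B) : Prop :=
  IsNormalEpiArrow f ∧ ∃ (E : C) (p : E ⟶ B), IsNormalEpiArrow p ∧
    ∃ (Pb : C) (p1 : Pb ⟶ E) (p2 : Pb ⟶ A), IsPullback p1 p2 p f ∧ IsTrivialExt R p1

/-- A normal extension with respect to the Galois structure of a reflection relative to
the class of normal epimorphisms. -/
def IsNormalExtN [HasZeroMorphisms C] (R : Reflection C P) {A B : C} (f : A ⟶ B) : Prop :=
  IsNormalEpiArrow f ∧
    ∃ (Pb : C) (p1 p2 : Pb ⟶ A), IsPullback p1 p2 f f ∧ IsTrivialExt R p1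

/-- The reflector is semi-left-exact: it preserves pullbacks of units along morphisms
with domain in the subcategory. -/
def SemiLeftExact (R : Reflection C P) : Prop :=
  ∀ ⦃A X Pb : C⦄ (x : X ⟶ R.F.obj A) (p1 : Pb ⟶ A) (p2 : Pb ⟶ X), P X →
    IsPullback p1 p2 (R.η.app A) x →
    IsPullback (R.F.map p1) (R.F.map p2) (R.F.map (R.η.app A)) (R.F.map x)

/-- The reflector has stable units: it preserves pullbacks of units along arbitrary
morphisms. -/
def StableUnits (R : Reflection C P) : Prop :=
  ∀ ⦃A X Pb : C⦄ (x : X ⟶ R.F.obj A) (p1 : Pb ⟶ A) (p2 : Pb ⟶ X),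
    IsPullback p1 p2 (R.η.app A) x →
    IsPullback (R.F.map p1) (R.F.map p2) (R.F.map (R.η.app A)) (R.F.map x)

/-- The reflection is admissible with respect to the class of normal epimorphisms:
the reflector preserves pullbacks of units along normal epimorphisms with domain in
the subcategory. -/
def AdmissibleN [HasZeroMorphisms C] (R : Reflection C P) : Prop :=
  ∀ ⦃A X Pb : C⦄ (x : X ⟶ R.F.obj A) (p1 : Pb ⟶ A) (p2 : Pb ⟶ X), P X →
    IsNormalEpiArrow x →
    IsPullback p1 p2 (R.η.app A) x →
    IsPullback (R.F.map p1) (R.F.map p2) (R.F.map (R.η.app A)) (R.F.map x)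

/-- The radical associated to a (normal epi)-reflection is idempotent. -/
def IdempotentRadical [HasZeroMorphisms C] (R : Reflection C P) : Prop :=
  ∀ ⦃A TA : C⦄ (t : TA ⟶ A), IsKernelOf t (R.η.app A) →
    ∀ ⦃T2 : C⦄ (t2 : T2 ⟶ TA), IsKernelOf t2 (R.η.app TA) → IsIso t2

/-- Condition (N) for a (normal epi)-reflection: for any morphism `f` with kernel
`k : K ⟶ A`, and any kernel `t : TK ⟶ K` of the unit at `K`, the composite `t ≫ k`
is a normal monomorphism. -/
def ConditionN [HasZeroMorphisms C] (R : Reflection C P) : Prop :=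
  ∀ ⦃A B : C⦄ (f : A ⟶ B) ⦃K : C⦄ (k : K ⟶ A), IsKernelOf k f →
    ∀ ⦃TK : C⦄ (t : TK ⟶ K), IsKernelOf t (R.η.app K) → IsNormalMonoArrow (t ≫ k)

/-- A torsion theory on a pointed category, given by a pair of full replete
subcategories. -/
structure TorsionTheory (C : Type u) [Category.{v} C] [HasZeroMorphisms C]
    (T F : C → Prop) : Prop where
  repleteT : Replete T
  repleteF : Replete F
  hom_zero : ∀ ⦃X Y : C⦄ (f : X ⟶ Y), T X → F Y → f = 0
  exists_ses : ∀ A : C, ∃ (TA FA : C) (t : TA ⟶ A) (q : A ⟶ FA),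
    T TA ∧ F FA ∧ IsShortExact t q

/-- Condition (N) for a torsion theory, formulated without reference to a chosen
reflector: for any morphism `f` with kernel `k : K ⟶ A` and any short exact sequence
`0 → TK → K → FK → 0` with `TK` torsion and `FK` torsion-free, the composite
`TK → A` is a normal monomorphism. -/
def TTConditionN [HasZeroMorphisms C] (T F : C → Prop) : Prop :=
  ∀ ⦃A B K TK FK : C⦄ (f : A ⟶ B) (k : K ⟶ A) (t : TK ⟶ K) (q : K ⟶ FK),
    IsKernelOf k f → T TK → F FK → IsShortExact t q → IsNormalMonoArrow (t ≫ k)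

/-- Condition (P) for a torsion theory: the torsion-free reflector is protoadditive
(formulated for every (normal epi)-reflection onto the torsion-free part). -/
def TTConditionP [HasZeroMorphisms C] (T F : C → Prop) : Prop :=
  ∀ R : Reflection C F, NormalEpiUnits R → IsProtoadditive R.F

/-- Orthogonality `e ↓ m` of two morphisms. -/
def Orthogonal {A B X Y : C} (e : A ⟶ B) (m : X ⟶ Y) : Prop :=
  ∀ (a : A ⟶ X) (b : B ⟶ Y), e ≫ b = a ≫ m →
    ∃! d : B ⟶ X, e ≫ d = a ∧ d ≫ m = b

/-- The class of morphisms orthogonal on the right to all members of `E`. -/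
def dnOrth (E : MorphismProperty C) : MorphismProperty C :=
  fun _ _ m => ∀ ⦃A B : C⦄ (e : A ⟶ B), E e → Orthogonal e m

/-- The class of morphisms orthogonal on the left to all members of `M`. -/
def upOrth (M : MorphismProperty C) : MorphismProperty C :=
  fun _ _ e => ∀ ⦃X Y : C⦄ (m : X ⟶ Y), M m → Orthogonal e m

/-- A prefactorisation system. -/
structure IsPrefactorisationSystem (E M : MorphismProperty C) : Prop where
  E_eq : E = upOrth M
  M_eq : M = dnOrth E

/-- A factorisation system. -/
structure IsFactorisationSystem (E M : MorphismProperty C) : Prop where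
  E_eq : E = upOrth M
  M_eq : M = dnOrth E
  fac : ∀ ⦃X Y : C⦄ (f : X ⟶ Y),
    ∃ (I : C) (e : X ⟶ I) (m : I ⟶ Y), E e ∧ M m ∧ e ≫ m = f

/-- A pullback-stable class of morphisms. -/
def PullbackStable (E : MorphismProperty C) : Prop :=
  ∀ ⦃P X Y Z : C⦄ (fst : P ⟶ X) (snd : P ⟶ Y) (f : X ⟶ Z) (g : Y ⟶ Z),
    IsPullback fst snd f g → E f → E snd

/-- The class of morphisms inverted by the reflector. -/
def invertedByR (R : Reflection C P) : MorphismProperty C :=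
  fun _ _ f => IsIso (R.F.map f)

/-- The class of morphisms all of whose pullbacks lie in `E` ("stably in `E`"). -/
def StablyIn (E : MorphismProperty C) : MorphismProperty C :=
  fun _ Y e => ∀ ⦃Pb W : C⦄ (fst : Pb ⟶ W) (snd : Pb ⟶ _) (g : W ⟶ Y),
    IsPullback fst snd g e → E fst

/-- The class of morphisms locally in `M`: some pullback along an effective descent
morphism lies in `M`. -/
def locallyIn [HasPullbacks C] (M : MorphismProperty C) : MorphismProperty C :=
  fun _ B f => ∃ (E : C) (p : E ⟶ B), IsEffectiveDescent p ∧
    ∃ (Pb : C) (p1 : Pb ⟶ E) (p2 : Pb ⟶ _), IsPullback p1 p2 p f ∧ M p1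

/-- The class `Ē` associated to a torsion theory: normal epimorphisms with torsion
kernel. -/
def Ebar [HasZeroMorphisms C] (T : C → Prop) : MorphismProperty C :=
  fun X _ e => IsNormalEpiArrow e ∧ ∃ (K : C) (k : K ⟶ X), IsKernelOf k e ∧ T K

/-- The class `M̄` associated to a torsion theory: morphisms with torsion-free
kernel. -/
def Mbar [HasZeroMorphisms C] (F : C → Prop) : MorphismProperty C :=
  fun X _ m => ∃ (K : C) (k : K ⟶ X), IsKernelOf k m ∧ F K

/-- A Birkhoff subcategory: a (regular epi)-reflective subcategory such that the
naturality squares of the unit at regular epimorphisms are pushouts. -/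
structure IsBirkhoff [HasZeroMorphisms C] (R : Reflection C P) : Prop where
  units_regEpi : ∀ X : C, Nonempty (RegularEpi (R.η.app X))
  pushout_units : ∀ ⦃A B : C⦄ (f : A ⟶ B), Nonempty (RegularEpi f) →
    IsPushout f (R.η.app A) (R.η.app B) (R.F.map f)

section ArrowInstances

variable [HasZeroMorphisms C]

instance instZeroArrowHom (f g : Arrow C) : Zero (f ⟶ g) :=
  ⟨{ left := 0, right := 0, w := by simp }⟩

@[simp] lemma arrowHomZero_left (f g : Arrow C) : (0 : f ⟶ g).left = 0 := rfl

@[simp] lemma arrowHomZero_right (f g : Arrow C) : (0 : f ⟶ g).right = 0 := rfl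

instance instArrowHasZeroMorphisms : HasZeroMorphisms (Arrow C) where
  comp_zero {X Y} f Z := by
    apply CommaMorphism.ext <;> simp
  zero_comp X {Y Z} f := by
    apply CommaMorphism.ext <;> simp

end ArrowInstances

section Helpers

variable [HasZeroMorphisms C]

lemma isKernelOf_of {K A B : C} {k : K ⟶ A} {f : A ⟶ B} (w : k ≫ f = 0) [Mono k]
    (h : ∀ ⦃W : C⦄ (a : W ⟶ A), a ≫ f = 0 → ∃ l : W ⟶ K, l ≫ k = a) : IsKernelOf k f :=
  ⟨w, ⟨KernelFork.IsLimit.ofι' k w (fun a ha => ⟨(h a ha).choose, (h a ha).choose_spec⟩)⟩⟩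

lemma IsKernelOf.lift {K A B : C} {k : K ⟶ A} {f : A ⟶ B} (h : IsKernelOf k f)
    ⦃W : C⦄ (a : W ⟶ A) (ha : a ≫ f = 0) : ∃ l : W ⟶ K, l ≫ k = a := by
  obtain ⟨w, ⟨hl⟩⟩ := h
  exact ⟨hl.lift (KernelFork.ofι a ha), hl.fac (KernelFork.ofι a ha) WalkingParallelPair.zero⟩

lemma IsKernelOf.mono {K A B : C} {k : K ⟶ A} {f : A ⟶ B} (h : IsKernelOf k f) : Mono k := by
  obtain ⟨w, ⟨hl⟩⟩ := h
  exact ⟨fun a b hab => Fork.IsLimit.hom_ext hl hab⟩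

/-- Kernels lift along pullbacks. -/
lemma IsKernelOf.pullback_lift {Q X Y Z K : C} {fst : Q ⟶ X} {snd : Q ⟶ Y} {f : X ⟶ Z}
    {g : Y ⟶ Z} (hpb : IsPullback fst snd f g) {k : K ⟶ X} (hk : IsKernelOf k f) :
    ∃ l : K ⟶ Q, l ≫ fst = k ∧ l ≫ snd = 0 ∧ IsKernelOf l snd := by
  have hw : k ≫ f = (0 : K ⟶ Y) ≫ g := by rw [zero_comp]; exact hk.1
  have h1 : hpb.lift k 0 hw ≫ fst = k := hpb.lift_fst _ _ _
  have h2 : hpb.lift k 0 hw ≫ snd = 0 := hpb.lift_snd _ _ _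
  haveI := hk.mono
  haveI : Mono (hpb.lift k 0 hw) := by
    haveI : Mono (hpb.lift k 0 hw ≫ fst) := by rw [h1]; infer_instance
    exact mono_of_mono _ fst
  refine ⟨_, h1, h2, isKernelOf_of h2 fun W a ha => ?_⟩
  obtain ⟨l, hl⟩ := hk.lift (a ≫ fst) (by rw [Category.assoc, hpb.w, reassoc_of% ha, zero_comp])
  refine ⟨l, hpb.hom_ext ?_ ?_⟩
  · rw [Category.assoc, h1, hl]
  · rw [Category.assoc, h2, ha, comp_zero]

/-- Kernels descend along pullbacks. -/
lemma IsKernelOf.pullback_desc {Q X Y Z K : C} {fst : Q ⟶ X} {snd : Q ⟶ Y} {f : X ⟶ Z}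
    {g : Y ⟶ Z} (hpb : IsPullback fst snd f g) {k : K ⟶ Q} (hk : IsKernelOf k snd) :
    IsKernelOf (k ≫ fst) f := by
  have hk0 : k ≫ snd = 0 := hk.1
  haveI := hk.mono
  haveI : Mono (k ≫ fst) := ⟨fun a b hab => by
    rw [← cancel_mono k]
    apply hpb.hom_ext
    · simpa using hab
    · simp [hk0]⟩
  refine isKernelOf_of (by rw [Category.assoc, hpb.w, reassoc_of% hk0, zero_comp])
    fun W a ha => ?_
  have hw : a ≫ f = (0 : W ⟶ Y) ≫ g := by rw [zero_comp, ha]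
  obtain ⟨l, hl⟩ := hk.lift (hpb.lift a 0 hw) (hpb.lift_snd _ _ _)
  exact ⟨l, by rw [reassoc_of% hl, hpb.lift_fst]⟩

/-- The unit at an object of the subcategory is invertible. -/
lemma Reflection.isIso_unit {P : C → Prop} (R : Reflection C P) {X : C} (hX : P X) :
    IsIso (R.η.app X) := by
  obtain ⟨g, hg, -⟩ := R.univ hX (𝟙 X)
  refine ⟨g, hg, ?_⟩
  apply (R.univ (R.mem X) (R.η.app X)).unique
  · exact (by simp [reassoc_of% hg] : R.η.app X ≫ g ≫ R.η.app X = R.η.app X)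
  · exact Category.comp_id _

/-- The torsion-free part is closed under subobjects. -/
lemma torsionFree_of_mono {Tp Fp : C → Prop} (tt : TorsionTheory C Tp Fp) {X Y : C}
    (m : X ⟶ Y) [Mono m] (hY : Fp Y) : Fp X := by
  obtain ⟨TX, FX, t, q, hT, hF, hse⟩ := tt.exists_ses X
  have ht : t = 0 := by
    rw [← cancel_mono m, zero_comp]
    exact tt.hom_zero _ hT hY
  obtain ⟨w, ⟨hc⟩⟩ := hse.isCokernel
  have hepi : Epi q := ⟨fun a b hab => Cofork.IsColimit.hom_ext hc hab⟩
  have hd : q ≫ hc.desc (CokernelCofork.ofπ (𝟙 X) (by rw [ht, zero_comp])) = 𝟙 X :=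
    hc.fac _ WalkingParallelPair.one
  refine tt.repleteF hF ⟨hc.desc (CokernelCofork.ofπ (𝟙 X) (by rw [ht, zero_comp])), q, ?_, hd⟩
  rw [← cancel_epi q, reassoc_of% hd, Category.comp_id]

end Helpers

/-- Proposition 3.1. Let `(Tp, Fp)` be a torsion theory in a
homological category satisfying condition (P) (the torsion-free reflector `R` is
protoadditive). Then for any effective descent morphism `f : A ⟶ B` the following are
equivalent: (1) `f` is a normal extension; (2) `f` is a central extension;
(3) the kernel of `f` lies in `Fp`. -/
theorem statement9 {C : Type u} [Category.{v} C] [HasZeroObject C] [HasZeroMorphisms C]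
    [HasPullbacks C]
    (hC : IsHomological C) {Tp Fp : C → Prop} (tt : TorsionTheory C Tp Fp)
    (R : Reflection C Fp)
    (hR : ∀ X : C, ∃ (K : C) (k : K ⟶ X), Tp K ∧ IsShortExact k (R.η.app X))
    (hP : IsProtoadditive R.F) :
    ∀ ⦃A B : C⦄ (f : A ⟶ B), IsEffectiveDescent f →
      ((IsNormalExt R f ↔ IsCentralExt R f) ∧
        (IsNormalExt R f ↔ ∃ (K : C) (k : K ⟶ A), IsKernelOf k f ∧ Fp K)) := by
  intro A B f hf
  have h12 : IsNormalExt R f → IsCentralExt R f := fun h => ⟨A, f, h.1, h.2⟩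
  have h23 : IsCentralExt R f → ∃ (K : C) (k : K ⟶ A), IsKernelOf k f ∧ Fp K := by
    rintro ⟨E, p, -, Q, p1, p2, hpb, htr⟩
    haveI := hC.hasFiniteLimits
    have hk : IsKernelOf (kernel.ι p1) p1 := ⟨kernel.condition p1, ⟨kernelIsKernel p1⟩⟩
    refine ⟨_, _, IsKernelOf.pullback_desc hpb.flip hk, ?_⟩
    have hk' := IsKernelOf.pullback_desc htr hk
    haveI := hk'.mono
    exact torsionFree_of_mono tt (kernel.ι p1 ≫ R.η.app Q) (R.mem Q)
  have h31 : (∃ (K : C) (k : K ⟶ A), IsKernelOf k f ∧ Fp K) → IsNormalExt R f := by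
    rintro ⟨K, k, hk, hK⟩
    have hpb := IsPullback.of_hasPullback f f
    refine ⟨hf, _, _, _, hpb, ?_⟩
    obtain ⟨l, -, hl0, hl⟩ := IsKernelOf.pullback_lift hpb.flip hk
    set p1 := pullback.fst f f with hp1
    obtain ⟨s, hs⟩ : ∃ s : A ⟶ pullback f f, s ≫ p1 = 𝟙 A :=
      ⟨hpb.lift (𝟙 A) (𝟙 A) rfl, hpb.lift_fst _ _ _⟩
    have hss : IsSplitShortExact l p1 s := ⟨hl, hs⟩
    have hFs := hP l p1 s hss
    have hQ := IsPullback.of_hasPullback (R.F.map p1) (R.η.app A)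
    obtain ⟨l', hl1, hl2, hl'⟩ := IsKernelOf.pullback_lift hQ hFs.isKernel
    have ns : s ≫ R.η.app _ = R.η.app A ≫ R.F.map s := R.η.naturality s
    have nl : l ≫ R.η.app _ = R.η.app K ≫ R.F.map l := R.η.naturality l
    have np : p1 ≫ R.η.app A = R.η.app _ ≫ R.F.map p1 := R.η.naturality p1
    have hsw : (R.η.app A ≫ R.F.map s) ≫ R.F.map p1 = 𝟙 A ≫ R.η.app A := by
      rw [Category.assoc, hFs.split, Category.id_comp]
      exact Category.comp_id _
    have hss' : IsSplitShortExact l' _ (hQ.lift _ _ hsw) := ⟨hl', hQ.lift_snd _ _ _⟩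
    have hiso : IsIso (hQ.lift (R.η.app _) p1 np.symm) := by
      refine hC.protomodular l p1 s l' _ _ (R.η.app K) _ (𝟙 A) hss hss' ?_ ?_ ?_
        (R.isIso_unit hK) inferInstance
      · apply hQ.hom_ext
        · rw [Category.assoc, Category.assoc, hQ.lift_fst, hl1]; exact nl
        · rw [Category.assoc, Category.assoc, hQ.lift_snd, hl2, hl0, comp_zero]
      · rw [hQ.lift_snd, Category.comp_id]
      · apply hQ.hom_ext
        · rw [Category.assoc, Category.assoc, hQ.lift_fst, hQ.lift_fst, Category.id_comp]; exact ns
        · rw [Category.assoc, Category.assoc, hQ.lift_snd, hQ.lift_snd, hs, Category.comp_id]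
    refine IsPullback.of_iso hQ (asIso (hQ.lift (R.η.app _) p1 np.symm)).symm (Iso.refl _)
      (Iso.refl _) (Iso.refl _) ?_ ?_ ?_ ?_
    · simp
    · simp
    · simp
    · simp
  exact ⟨⟨h12, fun h => h31 (h23 h)⟩, ⟨fun h => h23 (h12 h), h31⟩⟩

end ProtoPaper
end

section
/- Let A be a homological category. If a torsion theory (T, F) in A satisfies condition (N), then (Ē, M̄) is a stable factorisation system on A, and (T, F) is uniquely determined by (Ē, M̄). In fact, there is a bijective correspondence between (1) torsion theories in A satisfying condition (N) and (2) stable factorisation systems (E, M) on A such that every member of E is a normal epimorphism; the correspondence sends a torsion theory to (Ē, M̄), and a factorisation system (E, M) to the torsion theory whose torsion part consists of the objects T with T → 0 in E and whose torsion-free part consists of the objects F with F → 0 in M. -/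
open CategoryTheory CategoryTheory.Limits

universe v u v₂ u₂

namespace ProtoPaper

variable {C : Type u} [Category.{v} C]

variable {P : C → Prop}

section Helpers

variable [HasZeroMorphisms C]

lemma isKernelOf_iff {K A B : C} (k : K ⟶ A) (f : A ⟶ B) :
    IsKernelOf k f ↔ k ≫ f = 0 ∧ Mono k ∧
      ∀ ⦃Z : C⦄ (g : Z ⟶ A), g ≫ f = 0 → ∃ l : Z ⟶ K, l ≫ k = g := by
  constructor
  · rintro ⟨w, ⟨h⟩⟩
    refine ⟨w, ⟨fun a b hab => Fork.IsLimit.hom_ext h hab⟩, fun Z g hg => ?_⟩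
    obtain ⟨l, hl⟩ := KernelFork.IsLimit.lift' h g hg
    exact ⟨l, hl⟩
  · rintro ⟨w, hm, h⟩
    choose l hl using h
    exact ⟨w, ⟨KernelFork.IsLimit.ofι k w (fun g hg => l g hg) (fun g hg => hl g hg)
      (fun g hg m hmm => by rw [← cancel_mono k, hmm, hl])⟩⟩

lemma isCokernelOf_iff {K A B : C} (f : A ⟶ B) (k : K ⟶ A) :
    IsCokernelOf f k ↔ k ≫ f = 0 ∧ Epi f ∧
      ∀ ⦃Z : C⦄ (g : A ⟶ Z), k ≫ g = 0 → ∃ l : B ⟶ Z, f ≫ l = g := by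
  constructor
  · rintro ⟨w, ⟨h⟩⟩
    refine ⟨w, ⟨fun a b hab => Cofork.IsColimit.hom_ext h hab⟩, fun Z g hg => ?_⟩
    obtain ⟨l, hl⟩ := CokernelCofork.IsColimit.desc' h g hg
    exact ⟨l, hl⟩
  · rintro ⟨w, hm, h⟩
    choose l hl using h
    exact ⟨w, ⟨CokernelCofork.IsColimit.ofπ f w (fun g hg => l g hg) (fun g hg => hl g hg)
      (fun g hg m hmm => by rw [← cancel_epi f, hmm, hl])⟩⟩

/-- A normal epi is the cokernel of its kernel. -/
lemma coker_of_ker {K A B : C} {k : K ⟶ A} {f : A ⟶ B} (hf : IsNormalEpiArrow f)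
    (hk : IsKernelOf k f) : IsCokernelOf f k := by
  obtain ⟨K', k', h⟩ := hf
  rw [isCokernelOf_iff] at h ⊢
  rw [isKernelOf_iff] at hk
  refine ⟨hk.1, h.2.1, fun Z g hg => h.2.2 g ?_⟩
  obtain ⟨l, hl⟩ := hk.2.2 k' h.1
  rw [← hl, Category.assoc, hg, comp_zero]

lemma normalEpi_epi {A B : C} {f : A ⟶ B} (hf : IsNormalEpiArrow f) : Epi f := by
  obtain ⟨K', k', h⟩ := hf
  rw [isCokernelOf_iff] at h
  exact h.2.1

lemma normalEpi_regular {A B : C} {f : A ⟶ B} (hf : IsNormalEpiArrow f) :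
    Nonempty (RegularEpi f) := by
  obtain ⟨K', k', w, ⟨h⟩⟩ := hf
  exact ⟨⟨K', k', 0, by simp [w], h⟩⟩

lemma exists_kernel [HasFiniteLimits C] {A B : C} (f : A ⟶ B) :
    ∃ (K : C) (k : K ⟶ A), IsKernelOf k f := by
  refine ⟨kernel f, kernel.ι f, (isKernelOf_iff _ _).2 ⟨kernel.condition f, inferInstance,
    fun Z g hg => ⟨kernel.lift f g hg, by simp⟩⟩⟩

/-- The kernel and the section of a split epi are jointly epic. -/
lemma split_jointly_epic [HasFiniteLimits C] (hP : IsProtomodular C) {K A B Z : C}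
    {k : K ⟶ A} {f : A ⟶ B} {s : B ⟶ A} (h : IsSplitShortExact k f s) (u v : A ⟶ Z)
    (hk : k ≫ u = k ≫ v) (hs : s ≫ u = s ≫ v) : u = v := by
  have hker := h.isKernel
  rw [isKernelOf_iff] at hker
  have hm := hker.2.1
  have h' : IsSplitShortExact (equalizer.lift k hk) (equalizer.ι u v ≫ f)
      (equalizer.lift s hs) := by
    refine ⟨(isKernelOf_iff _ _).2 ⟨by simp [hker.1], ?_, ?_⟩, by simp [h.split]⟩
    · have : Mono (equalizer.lift k hk ≫ equalizer.ι u v) := by simpa using hm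
      exact mono_of_mono _ (equalizer.ι u v)
    · intro Z g hg
      obtain ⟨l, hl⟩ := hker.2.2 (g ≫ equalizer.ι u v) (by simpa using hg)
      exact ⟨l, by rw [← cancel_mono (equalizer.ι u v)]; simpa using hl⟩
  have : IsIso (equalizer.ι u v) :=
    hP _ _ _ _ _ _ (𝟙 K) (equalizer.ι u v) (𝟙 B) h' h (by simp) (by simp) (by simp)
      inferInstance inferInstance
  rw [← cancel_epi (equalizer.ι u v)]
  exact equalizer.condition u v

/-- In a pointed protomodular category with finite limits regular epis are normal. -/
lemma regular_normalEpi [HasFiniteLimits C] (hP : IsProtomodular C) {A B : C} {f : A ⟶ B}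
    (hf : Nonempty (RegularEpi f)) : IsNormalEpiArrow f := by
  obtain ⟨r⟩ := hf
  obtain ⟨K, k, hk⟩ := exists_kernel f
  rw [isKernelOf_iff] at hk
  have hm := hk.2.1
  have hepi : Epi f := ⟨fun a b hab => Cofork.IsColimit.hom_ext r.isColimit hab⟩
  refine ⟨K, k, (isCokernelOf_iff _ _).2 ⟨hk.1, hepi, fun Z g hg => ?_⟩⟩
  obtain ⟨R, p₁, p₂, hpb⟩ : ∃ (R : C) (p₁ p₂ : R ⟶ A), IsPullback p₁ p₂ f f :=
    ⟨_, _, _, IsPullback.of_hasPullback f f⟩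
  have key : p₁ ≫ g = p₂ ≫ g := by
    have hsp : IsSplitShortExact (hpb.lift 0 k (by simp [hk.1]))
        p₁ (hpb.lift (𝟙 A) (𝟙 A) rfl) := by
      refine ⟨(isKernelOf_iff _ _).2 ⟨by simp, ?_, ?_⟩, by simp⟩
      · have : Mono (hpb.lift 0 k (by simp [hk.1]) ≫ p₂) := by simpa using hm
        exact mono_of_mono _ p₂
      · intro Z x hx
        obtain ⟨l, hl⟩ := hk.2.2 (x ≫ p₂) (by
          rw [Category.assoc, ← hpb.w, ← Category.assoc, hx, zero_comp])
        refine ⟨l, hpb.hom_ext ?_ ?_⟩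
        · simp [hx]
        · simpa using hl
    apply split_jointly_epic hP hsp
    · rw [← Category.assoc, ← Category.assoc]
      simp [hg]
    · rw [← Category.assoc, ← Category.assoc]
      simp
  have hw : r.left ≫ g = r.right ≫ g := by
    have := congrArg (fun t => hpb.lift r.left r.right r.w ≫ t) key
    simpa only [← Category.assoc, IsPullback.lift_fst, IsPullback.lift_snd] using this
  obtain ⟨l, hl⟩ := Cofork.IsColimit.desc' r.isColimit g hw
  exact ⟨l, hl⟩

lemma ker_unique {K K' A B : C} {k : K ⟶ A} {k' : K' ⟶ A} {f : A ⟶ B}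
    (h : IsKernelOf k f) (h' : IsKernelOf k' f) : Nonempty (K ≅ K') := by
  obtain ⟨w, ⟨h⟩⟩ := h
  obtain ⟨w', ⟨h'⟩⟩ := h'
  exact ⟨h.conePointUniqueUpToIso h'⟩

lemma coker_unique {K A B B' : C} {k : K ⟶ A} {f : A ⟶ B} {f' : A ⟶ B'}
    (h : IsCokernelOf f k) (h' : IsCokernelOf f' k) : Nonempty (B ≅ B') := by
  obtain ⟨w, ⟨h⟩⟩ := h
  obtain ⟨w', ⟨h'⟩⟩ := h'
  exact ⟨h.coconePointUniqueUpToIso h'⟩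

/-- Kernels of the two parallel sides of a pullback. -/
lemma ker_pullback {P X Y Z K : C} {fst : P ⟶ X} {snd : P ⟶ Y} {f : X ⟶ Z} {g : Y ⟶ Z}
    (h : IsPullback fst snd f g) {k : K ⟶ X} (hk : IsKernelOf k f) :
    ∃ k' : K ⟶ P, IsKernelOf k' snd := by
  rw [isKernelOf_iff] at hk
  have hm := hk.2.1
  refine ⟨h.lift k 0 (by simp [hk.1]), (isKernelOf_iff _ _).2 ⟨by simp, ?_, ?_⟩⟩
  · have : Mono (h.lift k 0 (by simp [hk.1]) ≫ fst) := by simpa using hm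
    exact mono_of_mono _ fst
  · intro W x hx
    obtain ⟨l, hl⟩ := hk.2.2 (x ≫ fst) (by
      rw [Category.assoc, h.w, ← Category.assoc, hx, zero_comp])
    exact ⟨l, h.hom_ext (by simpa using hl) (by simp [hx])⟩

/-- The kernel as a pullback along the zero object. -/
lemma ker_isPullback {K A B O : C} (hO : IsZero O) {k : K ⟶ A} {f : A ⟶ B}
    (hk : IsKernelOf k f) : IsPullback k (0 : K ⟶ O) f (0 : O ⟶ B) := by
  rw [isKernelOf_iff] at hk
  have hm := hk.2.1
  refine ⟨⟨by simp [hk.1]⟩, ⟨PullbackCone.IsLimit.mk _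
    (fun s => (hk.2.2 s.fst (by simp [s.condition])).choose)
    (fun s => (hk.2.2 s.fst (by simp [s.condition])).choose_spec)
    (fun s => hO.eq_of_tgt _ _) ?_⟩⟩
  intro s m h1 h2
  rw [← cancel_mono k, h1]
  exact (hk.2.2 s.fst (by simp [s.condition])).choose_spec.symm

lemma ker_to_zero {X O : C} (hO : IsZero O) : IsKernelOf (𝟙 X) (0 : X ⟶ O) :=
  (isKernelOf_iff _ _).2 ⟨by simp, inferInstance, fun _ g _ => ⟨g, by simp⟩⟩

lemma coker_to_zero {X O : C} (hO : IsZero O) : IsCokernelOf (0 : X ⟶ O) (𝟙 X) :=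
  (isCokernelOf_iff _ _).2 ⟨by simp, ⟨fun _ _ _ => hO.eq_of_src _ _⟩,
    fun _ g hg => ⟨0, by simpa using hg.symm⟩⟩

lemma orth_of_zero {A B X Y K L : C} {e : A ⟶ B} {m : X ⟶ Y} {k : K ⟶ A} {l : L ⟶ X}
    (he : IsNormalEpiArrow e) (hk : IsKernelOf k e) (hl : IsKernelOf l m)
    (h0 : ∀ f : K ⟶ L, f = 0) : Orthogonal e m := by
  intro a b hab
  have hc := (isCokernelOf_iff _ _).1 (coker_of_ker he hk)
  have hepi := hc.2.1
  rw [isKernelOf_iff] at hl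
  obtain ⟨x, hx⟩ := hl.2.2 (k ≫ a) (by
    rw [Category.assoc, ← hab, ← Category.assoc, hc.1, zero_comp])
  obtain ⟨d, hd⟩ := hc.2.2 a (by rw [← hx, h0 x, zero_comp])
  refine ⟨d, ⟨hd, ?_⟩, fun d' hd' => ?_⟩
  · rw [← cancel_epi e, ← Category.assoc, hd, hab]
  · rw [← cancel_epi e, hd, hd'.1]

/-- Constructing factorisation systems. -/
lemma mk_factorisation (E M : MorphismProperty C)
    (hE : ∀ ⦃X Y Z : C⦄ (e : X ⟶ Y) (i : Y ⟶ Z), IsIso i → E e → E (e ≫ i))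
    (hM : ∀ ⦃X Y Z : C⦄ (i : X ⟶ Y) (m : Y ⟶ Z), IsIso i → M m → M (i ≫ m))
    (ho : ∀ ⦃A B X Y : C⦄ (e : A ⟶ B) (m : X ⟶ Y), E e → M m → Orthogonal e m)
    (fac : ∀ ⦃X Y : C⦄ (f : X ⟶ Y),
      ∃ (I : C) (e : X ⟶ I) (m : I ⟶ Y), E e ∧ M m ∧ e ≫ m = f) :
    IsFactorisationSystem E M := by
  refine ⟨?_, ?_, fac⟩
  · ext X Y f
    refine ⟨fun h _ _ m hm => ho f m h hm, fun h => ?_⟩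
    obtain ⟨I, e, m, he, hm, rfl⟩ := fac f
    obtain ⟨d, ⟨h1, h2⟩, -⟩ := h m hm e (𝟙 _) (by simp)
    have hu := (ho e m he hm e m rfl).unique (y₁ := m ≫ d) (y₂ := 𝟙 _)
      ⟨by simpa using h1, by simp [h2]⟩ ⟨by simp, by simp⟩
    exact hE e m ⟨d, hu, h2⟩ he
  · ext X Y f
    refine ⟨fun h _ _ e he => ho e f he h, fun h => ?_⟩
    obtain ⟨I, e, m, he, hm, rfl⟩ := fac f
    obtain ⟨d, ⟨h1, h2⟩, -⟩ := h e he (𝟙 _) m (by simp)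
    have hu := (ho e m he hm e m rfl).unique (y₁ := d ≫ e) (y₂ := 𝟙 _)
      ⟨by rw [← Category.assoc, h1, Category.id_comp], by simpa using h2⟩ ⟨by simp, by simp⟩
    exact hM e m ⟨d, h1, hu⟩ hm

lemma Ebar_fac [HasZeroObject C] (hC : IsHomological C) {Tp Fp : C → Prop}
    (hT : TorsionTheory C Tp Fp) (hN : TTConditionN Tp Fp) {A B : C} (f : A ⟶ B) :
    ∃ (I : C) (e : A ⟶ I) (m : I ⟶ B), Ebar Tp e ∧ Mbar Fp m ∧ e ≫ m = f := by
  have := hC.hasFiniteLimits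
  obtain ⟨K, k, hk⟩ := exists_kernel f
  obtain ⟨TK, FK, t, q, hTK, hFK, hs⟩ := hT.exists_ses K
  obtain ⟨D, g, hg⟩ := hN f k t q hk hTK hFK hs
  obtain ⟨I, e, n, he, hn, rfl⟩ := hC.regEpiMonoFac g
  have hen := regular_normalEpi hC.protomodular he
  have hke : IsKernelOf (t ≫ k) e := by
    rw [isKernelOf_iff] at hg ⊢
    refine ⟨by rw [← cancel_mono n]; simpa using hg.1, hg.2.1, fun Z x hx => hg.2.2 x ?_⟩
    rw [← Category.assoc, hx, zero_comp]
  have hce := (isCokernelOf_iff _ _).1 (coker_of_ker hen hke)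
  have hk' := (isKernelOf_iff _ _).1 hk
  have hkm := hk'.2.1
  obtain ⟨m, rfl⟩ := hce.2.2 f (by rw [Category.assoc, hk'.1, comp_zero])
  refine ⟨I, e, m, ⟨hen, TK, t ≫ k, hke, hTK⟩, ?_, rfl⟩
  obtain ⟨L, l, hl⟩ := exists_kernel m
  refine ⟨L, l, hl, ?_⟩
  have hl' := (isKernelOf_iff _ _).1 hl
  have hlm := hl'.2.1
  obtain ⟨p, hp⟩ := hl'.2.2 (k ≫ e) (by simpa using hk'.1)
  have hpb : IsPullback k p e l := by
    have hex : ∀ s : PullbackCone e l, ∃ x, x ≫ k = s.fst := fun s => hk'.2.2 s.fst (by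
      rw [← Category.assoc, s.condition, Category.assoc, hl'.1, comp_zero])
    refine ⟨⟨hp.symm⟩, ⟨PullbackCone.IsLimit.mk _ (fun s => (hex s).choose)
      (fun s => (hex s).choose_spec) ?_ ?_⟩⟩
    · intro s
      rw [← cancel_mono l, Category.assoc, hp, ← Category.assoc, (hex s).choose_spec,
        s.condition]
    · intro s x h1 h2
      rw [← cancel_mono k, h1, (hex s).choose_spec]
  have hpn := regular_normalEpi hC.protomodular (hC.regEpiStable _ _ _ _ hpb he)
  have hst := (isKernelOf_iff _ _).1 hs.isKernel
  have hke' := (isKernelOf_iff _ _).1 hke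
  have htp : IsKernelOf t p := by
    refine (isKernelOf_iff _ _).2 ⟨?_, hst.2.1, fun Z x hx => ?_⟩
    · rw [← cancel_mono l, Category.assoc, hp, zero_comp, ← Category.assoc, hke'.1]
    · obtain ⟨y, hy⟩ := hke'.2.2 (x ≫ k) (by
        rw [Category.assoc, ← hp, ← Category.assoc, hx, zero_comp])
      exact ⟨y, by rw [← cancel_mono k, ← hy, Category.assoc]⟩
  obtain ⟨i⟩ := coker_unique hs.isCokernel (coker_of_ker hpn htp)
  exact hT.repleteF hFK i

open ZeroObject in
lemma part1 [HasZeroObject C] (hC : IsHomological C) (Tp Fp : C → Prop)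
    (hT : TorsionTheory C Tp Fp) (hN : TTConditionN Tp Fp) :
    IsFactorisationSystem (Ebar Tp) (Mbar Fp) ∧ PullbackStable (Ebar Tp) ∧
        (∀ ⦃X Y : C⦄ (e : X ⟶ Y), Ebar Tp e → IsNormalEpiArrow e) ∧
        (∀ X : C, Tp X ↔ Ebar Tp (0 : X ⟶ (0 : C))) ∧
        (∀ X : C, Fp X ↔ Mbar Fp (0 : X ⟶ (0 : C))) := by
  have := hC.hasFiniteLimits
  refine ⟨mk_factorisation _ _ ?_ ?_ ?_ (fun X Y f => Ebar_fac hC hT hN f), ?_,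
    fun X Y e h => h.1, fun X => ⟨fun h => ?_, ?_⟩, fun X => ⟨fun h => ?_, ?_⟩⟩
  · rintro X Y Z e i hi ⟨⟨L, l, hl⟩, K, k, hk, hK⟩
    rw [isCokernelOf_iff] at hl
    rw [isKernelOf_iff] at hk
    have := hl.2.1
    refine ⟨⟨L, l, (isCokernelOf_iff _ _).2 ⟨by rw [← Category.assoc, hl.1, zero_comp],
      epi_comp _ _, fun W g hg => ?_⟩⟩, K, k, (isKernelOf_iff _ _).2
      ⟨by rw [← Category.assoc, hk.1, zero_comp], hk.2.1, fun W g hg => hk.2.2 g ?_⟩, hK⟩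
    · obtain ⟨x, hx⟩ := hl.2.2 g hg
      exact ⟨inv i ≫ x, by simp [hx]⟩
    · rw [← cancel_mono i, Category.assoc, hg, zero_comp]
  · rintro X Y Z i m hi ⟨K, k, hk, hK⟩
    rw [isKernelOf_iff] at hk
    have := hk.2.1
    refine ⟨K, k ≫ inv i, (isKernelOf_iff _ _).2 ⟨by simp [hk.1], mono_comp _ _,
      fun W g hg => ?_⟩, hK⟩
    obtain ⟨x, hx⟩ := hk.2.2 (g ≫ i) (by simpa using hg)
    exact ⟨x, by rw [← Category.assoc, hx]; simp⟩
  · rintro A B X Y e m ⟨he, K, k, hk, hK⟩ ⟨L, l, hl, hL⟩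
    exact orth_of_zero he hk hl (fun f => hT.hom_zero f hK hL)
  · rintro P X Y Z fst snd f g hpb ⟨hf, K, k, hk, hK⟩
    obtain ⟨k', hk'⟩ := ker_pullback hpb hk
    exact ⟨regular_normalEpi hC.protomodular (hC.regEpiStable _ _ _ _ hpb
      (normalEpi_regular hf)), K, k', hk', hK⟩
  · exact ⟨⟨X, 𝟙 X, coker_to_zero (isZero_zero C)⟩, X, 𝟙 X, ker_to_zero (isZero_zero C), h⟩
  · rintro ⟨-, K, k, hk, hK⟩
    obtain ⟨i⟩ := ker_unique hk (ker_to_zero (isZero_zero C))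
    exact hT.repleteT hK i
  · exact ⟨X, 𝟙 X, ker_to_zero (isZero_zero C), h⟩
  · rintro ⟨K, k, hk, hK⟩
    obtain ⟨i⟩ := ker_unique hk (ker_to_zero (isZero_zero C))
    exact hT.repleteF hK i

open ZeroObject in
lemma part2 [HasZeroObject C] (hC : IsHomological C) (E M : MorphismProperty C)
    (hF : IsFactorisationSystem E M) (hS : PullbackStable E)
    (hE : ∀ ⦃X Y : C⦄ (e : X ⟶ Y), E e → IsNormalEpiArrow e) :
    TorsionTheory C (fun X => E (0 : X ⟶ (0 : C))) (fun X => M (0 : X ⟶ (0 : C)))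
          ∧ TTConditionN (fun X => E (0 : X ⟶ (0 : C))) (fun X => M (0 : X ⟶ (0 : C)))
          ∧ E = Ebar (fun X => E (0 : X ⟶ (0 : C)))
          ∧ M = Mbar (fun X => M (0 : X ⟶ (0 : C))) := by
  have := hC.hasFiniteLimits
  have hz := isZero_zero C
  have ho : ∀ ⦃A B X Y : C⦄ (e : A ⟶ B) (m : X ⟶ Y), E e → M m → Orthogonal e m := by
    intro A B X Y e m he hm
    rw [hF.E_eq] at he
    exact he m hm
  have hMdn : ∀ ⦃X Y : C⦄ (m : X ⟶ Y),
      (∀ ⦃A B : C⦄ (e : A ⟶ B), E e → Orthogonal e m) → M m := by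
    intro X Y m h
    rw [hF.M_eq]
    exact h
  have hEup : ∀ ⦃A B : C⦄ (e : A ⟶ B),
      (∀ ⦃X Y : C⦄ (m : X ⟶ Y), M m → Orthogonal e m) → E e := by
    intro X Y m h
    rw [hF.E_eq]
    exact h
  have hMpb : ∀ ⦃P X Y Z : C⦄ (fst : P ⟶ X) (snd : P ⟶ Y) (f : X ⟶ Z) (g : Y ⟶ Z),
      IsPullback fst snd f g → M f → M snd := by
    intro P X Y Z fst snd f g hpb hf
    refine hMdn _ fun A B e he a b hab => ?_
    have hepi := normalEpi_epi (hE e he)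
    obtain ⟨d, ⟨h1, h2⟩, -⟩ := ho e f he hf (a ≫ fst) (b ≫ g) (by
      rw [← Category.assoc, hab, Category.assoc, Category.assoc, hpb.w])
    refine ⟨hpb.lift d b h2, ⟨hpb.hom_ext (by simpa using h1) (by simpa using hab),
      by simp⟩, fun d' hd' => ?_⟩
    rw [← cancel_epi e, hd'.1]
    exact (hpb.hom_ext (by simpa using h1) (by simpa using hab)).symm
  have hEK : ∀ ⦃K A B : C⦄ (k : K ⟶ A) (e : A ⟶ B), IsKernelOf k e → E e →
      E (0 : K ⟶ (0 : C)) := fun K A B k e hk he => hS _ _ _ _ (ker_isPullback hz hk) he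
  have hMK : ∀ ⦃K A B : C⦄ (k : K ⟶ A) (e : A ⟶ B), IsKernelOf k e → M e →
      M (0 : K ⟶ (0 : C)) := fun K A B k e hk he => hMpb _ _ _ _ (ker_isPullback hz hk) he
  have h0 : ∀ ⦃X Y : C⦄ (f : X ⟶ Y), E (0 : X ⟶ (0 : C)) → M (0 : Y ⟶ (0 : C)) → f = 0 := by
    intro X Y f hX hY
    obtain ⟨d, ⟨h1, -⟩, -⟩ := ho _ _ hX hY f 0 (by simp)
    rw [← h1, zero_comp]
  have isoPb : ∀ ⦃X Y : C⦄ (i : X ≅ Y), IsPullback i.inv (0 : Y ⟶ (0 : C)) (0 : X ⟶ (0 : C))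
      (0 : (0 : C) ⟶ (0 : C)) := fun X Y i =>
    IsPullback.of_horiz_isIso_mono ⟨hz.eq_of_tgt _ _⟩
  refine ⟨⟨?_, ?_, h0, ?_⟩, ?_, ?_, ?_⟩
  · exact fun X Y h i => hS _ _ _ _ (isoPb i) h
  · exact fun X Y h i => hMpb _ _ _ _ (isoPb i) h
  · intro A
    obtain ⟨I, q, m, hq, hm, -⟩ := hF.fac (0 : A ⟶ (0 : C))
    obtain rfl : m = 0 := hz.eq_of_tgt _ _
    obtain ⟨K, k, hk⟩ := exists_kernel q
    exact ⟨K, I, k, q, hEK k q hk hq, hm, hk, coker_of_ker (hE q hq) hk⟩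
  · intro A B K TK FK f k t q hk hTK hFK hs
    obtain ⟨I, e, m, he, hm, rfl⟩ := hF.fac f
    refine ⟨I, e, ?_⟩
    obtain ⟨L, l, hl⟩ := exists_kernel m
    obtain ⟨J, j, hj⟩ := exists_kernel e
    have hJ := hEK j e hj he
    have hL := hMK l m hl hm
    have hst := (isKernelOf_iff _ _).1 hs.isKernel
    rw [isKernelOf_iff] at hk hl hj ⊢
    have := hk.2.1
    have := hst.2.1
    refine ⟨?_, mono_comp _ _, fun Z x hx => ?_⟩
    · obtain ⟨y, hy⟩ := hl.2.2 ((t ≫ k) ≫ e) (by simp [hk.1])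
      rw [← hy, h0 y hTK hL, zero_comp]
    · obtain ⟨x', rfl⟩ := hj.2.2 x hx
      obtain ⟨j', rfl⟩ := hk.2.2 j (by rw [← Category.assoc, hj.1, zero_comp])
      obtain ⟨j'', rfl⟩ := hst.2.2 j' (h0 _ hJ hFK)
      exact ⟨x' ≫ j'', by simp⟩
  · ext A B e
    refine ⟨fun he => ?_, ?_⟩
    · obtain ⟨K, k, hk⟩ := exists_kernel e
      exact ⟨hE e he, K, k, hk, hEK k e hk he⟩
    · rintro ⟨he, K, k, hk, hK⟩
      refine hEup e fun X Y m hm => ?_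
      obtain ⟨L, l, hl⟩ := exists_kernel m
      exact orth_of_zero he hk hl fun f => h0 f hK (hMK l m hl hm)
  · ext X Y m
    refine ⟨fun hm => ?_, ?_⟩
    · obtain ⟨K, k, hk⟩ := exists_kernel m
      exact ⟨K, k, hk, hMK k m hk hm⟩
    · rintro ⟨L, l, hl, hL⟩
      refine hMdn m fun A B e he => ?_
      obtain ⟨K, k, hk⟩ := exists_kernel e
      exact orth_of_zero (hE e he) hk hl fun f => h0 f (hEK k e hk he) hL

end Helpers

open ZeroObject in
/-- Proposition 3.3. In a homological category, a torsion theory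
satisfying condition (N) gives rise to the stable factorisation system `(Ē, M̄)`
(whose left class consists of normal epimorphisms), the torsion theory is uniquely
determined by it, and this assignment is a bijective correspondence between torsion
theories satisfying condition (N) and stable factorisation systems `(E, M)` in which
every member of `E` is a normal epimorphism: the inverse assigns to `(E, M)` the
torsion theory whose torsion (resp. torsion-free) objects are those `X` with
`X ⟶ 0` in `E` (resp. in `M`). -/
theorem statement11 {C : Type u} [Category.{v} C] [HasZeroObject C] [HasZeroMorphisms C]
    (hC : IsHomological C) :
    (∀ (Tp Fp : C → Prop), TorsionTheory C Tp Fp → TTConditionN Tp Fp →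
      IsFactorisationSystem (Ebar Tp) (Mbar Fp) ∧ PullbackStable (Ebar Tp) ∧
        (∀ ⦃X Y : C⦄ (e : X ⟶ Y), Ebar Tp e → IsNormalEpiArrow e) ∧
        (∀ X : C, Tp X ↔ Ebar Tp (0 : X ⟶ (0 : C))) ∧
        (∀ X : C, Fp X ↔ Mbar Fp (0 : X ⟶ (0 : C))))
    ∧ (∀ (E M : MorphismProperty C), IsFactorisationSystem E M → PullbackStable E →
        (∀ ⦃X Y : C⦄ (e : X ⟶ Y), E e → IsNormalEpiArrow e) →
        TorsionTheory C (fun X => E (0 : X ⟶ (0 : C))) (fun X => M (0 : X ⟶ (0 : C)))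
          ∧ TTConditionN (fun X => E (0 : X ⟶ (0 : C))) (fun X => M (0 : X ⟶ (0 : C)))
          ∧ E = Ebar (fun X => E (0 : X ⟶ (0 : C)))
          ∧ M = Mbar (fun X => M (0 : X ⟶ (0 : C))))
    ∧ (∀ (Tp Fp Tp' Fp' : C → Prop),
        TorsionTheory C Tp Fp → TTConditionN Tp Fp →
        TorsionTheory C Tp' Fp' → TTConditionN Tp' Fp' →
        Ebar Tp = Ebar Tp' → Mbar Fp = Mbar Fp' →
        (∀ X : C, Tp X ↔ Tp' X) ∧ (∀ X : C, Fp X ↔ Fp' X)) := by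
  refine ⟨part1 hC, part2 hC, ?_⟩
  intro Tp Fp Tp' Fp' hT hN hT' hN' hE hM
  obtain ⟨-, -, -, h1, h2⟩ := part1 hC Tp Fp hT hN
  obtain ⟨-, -, -, h1', h2'⟩ := part1 hC Tp' Fp' hT' hN'
  exact ⟨fun X => by rw [h1, h1', hE], fun X => by rw [h2, h2', hM]⟩


end ProtoPaper
end
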